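/- arXiv:1209.0155 — 2 statements merged into one kernel-verified Lean document; each statement's English description precedes it below -/
import Mathlib

section
/- Let n ≥ 1, m ≥ 1, and let F : ℝⁿ → ℝ be a homogeneous polynomial of degree m satisfying ‖∇F(x)‖² = m²‖x‖^(2m−2) for all x ∈ ℝⁿ. Define G : ℝⁿ → ℝ by G(x) = 2F(x)² − ‖x‖^(2m). Then G is a homogeneous polynomial of degree 2m and ‖∇G(x)‖² = 4m²‖x‖^(4m−2) for all x ∈ ℝⁿ. -/
noncomputable section

/-- `F` is the evaluation of a homogeneous `MvPolynomial` of degree `m` in `n` variables. -/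
def IsHomPoly (n m : ℕ) (F : EuclideanSpace ℝ (Fin n) → ℝ) : Prop :=
  ∃ P : MvPolynomial (Fin n) ℝ, P.IsHomogeneous m ∧
    ∀ x : EuclideanSpace ℝ (Fin n), F x = MvPolynomial.eval (fun i => x i) P

open MvPolynomial in
/-- A homogeneous polynomial of degree `m` scales with the power `t ^ m`. -/
theorem MvPolynomial.IsHomogeneous.eval_mul_left {σ R : Type*} [CommSemiring R]
    {P : MvPolynomial σ R} {m : ℕ} (hP : P.IsHomogeneous m) (t : R) (x : σ → R) :
    eval (fun i => t * x i) P = t ^ m * eval x P := by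
  rw [eval_eq, eval_eq, Finset.mul_sum]
  refine Finset.sum_congr rfl fun d hd => ?_
  rw [hP.degree_eq_sum_deg_support hd]
  simp only [mul_pow, Finset.prod_mul_distrib, Finset.prod_pow_eq_pow_sum]
  ring

namespace IsHomPoly

variable {n m : ℕ} {F : EuclideanSpace ℝ (Fin n) → ℝ}

theorem differentiable (hF : IsHomPoly n m F) : Differentiable ℝ F := by
  obtain ⟨P, -, hP⟩ := hF
  rw [funext hP]
  intro x
  exact (AnalyticOnNhd.eval_continuousLinearMap'
    (fun i => (EuclideanSpace.proj i : EuclideanSpace ℝ (Fin n) →L[ℝ] ℝ)) P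
    x (Set.mem_univ x)).differentiableAt

theorem map_smul (hF : IsHomPoly n m F) (t : ℝ) (x : EuclideanSpace ℝ (Fin n)) :
    F (t • x) = t ^ m * F x := by
  obtain ⟨P, hm, hP⟩ := hF
  simpa [hP] using hm.eval_mul_left t (fun i => x i)

/-- Euler's identity. -/
theorem inner_gradient_self (hF : IsHomPoly n m F) (x : EuclideanSpace ℝ (Fin n)) :
    inner ℝ (gradient F x) x = m * F x := by
  have hline : HasDerivAt (fun t : ℝ => t • x) x 1 := by
    simpa using (hasDerivAt_id (1 : ℝ)).smul_const x
  have hcomp : HasDerivAt (fun t : ℝ => F (t • x)) (fderiv ℝ F x x) 1 := by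
    have hx : HasFDerivAt F (fderiv ℝ F x) ((1 : ℝ) • x) := by
      simpa using (hF.differentiable x).hasFDerivAt
    exact hx.comp_hasDerivAt 1 hline
  have hpow : HasDerivAt (fun t : ℝ => F (t • x)) (m * F x) 1 := by
    simp only [hF.map_smul]
    simpa using (hasDerivAt_pow m (1 : ℝ)).mul_const (F x)
  rw [inner_gradient_left]
  exact hcomp.unique hpow

theorem two_mul_sq_sub_norm_pow (hF : IsHomPoly n m F) :
    IsHomPoly n (2 * m) fun x => 2 * F x ^ 2 - ‖x‖ ^ (2 * m) := by
  obtain ⟨P, hm, hP⟩ := hF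
  refine ⟨MvPolynomial.C 2 * P ^ 2 - (∑ i, MvPolynomial.X i ^ 2) ^ m, ?_, fun x => ?_⟩
  · refine ((mul_comm m 2 ▸ hm.pow 2).C_mul 2).sub (.pow (.sum _ _ _ fun i _ => ?_) m)
    simpa using (MvPolynomial.isHomogeneous_X ℝ i).pow 2
  · simp [hP, pow_mul, EuclideanSpace.real_norm_sq_eq]

end IsHomPoly

theorem hasGradientAt_norm_pow_two_mul {E : Type*} [NormedAddCommGroup E] [InnerProductSpace ℝ E]
    [CompleteSpace E] (m : ℕ) (x : E) :
    HasGradientAt (fun y : E => ‖y‖ ^ (2 * m)) ((2 * m * ‖x‖ ^ (2 * m - 2)) • x) x := by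
  rw [hasGradientAt_iff_hasFDerivAt]
  simp only [pow_mul]
  convert! (hasStrictFDerivAt_norm_sq x).hasFDerivAt.pow m using 1
  ext y
  rw [show 2 * m - 2 = 2 * (m - 1) by lia]
  simp [pow_mul]
  ring

theorem HasGradientAt.two_mul_sq_sub_norm_pow {E : Type*} [NormedAddCommGroup E]
    [InnerProductSpace ℝ E] [CompleteSpace E] {F : E → ℝ} {F' x : E}
    (hF : HasGradientAt F F' x) (m : ℕ) :
    HasGradientAt (fun y : E => 2 * F y ^ 2 - ‖y‖ ^ (2 * m))
      ((4 * F x) • F' - (2 * m * ‖x‖ ^ (2 * m - 2)) • x) x := by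
  rw [hasGradientAt_iff_hasFDerivAt, map_sub]
  refine HasFDerivAt.sub ?_ (hasGradientAt_norm_pow_two_mul m x).hasFDerivAt
  convert! (hF.hasFDerivAt.pow 2).const_mul 2 using 1
  ext y
  simp
  ring

/-- If `F` is a homogeneous polynomial solution of the eiconal equation of degree `m`, then
`G = 2F² - ‖x‖^{2m}` is a homogeneous polynomial solution of degree `2m`. -/
theorem doubling_construction {n m : ℕ} (hn : 1 ≤ n) (hm : 1 ≤ m)
    (F : EuclideanSpace ℝ (Fin n) → ℝ) (hF : IsHomPoly n m F)
    (hgrad : ∀ x : EuclideanSpace ℝ (Fin n),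
      ‖gradient F x‖ ^ 2 = (m : ℝ) ^ 2 * ‖x‖ ^ (2 * m - 2))
    (G : EuclideanSpace ℝ (Fin n) → ℝ)
    (hG : ∀ x : EuclideanSpace ℝ (Fin n), G x = 2 * F x ^ 2 - ‖x‖ ^ (2 * m)) :
    IsHomPoly n (2 * m) G ∧
      ∀ x : EuclideanSpace ℝ (Fin n),
        ‖gradient G x‖ ^ 2 = 4 * (m : ℝ) ^ 2 * ‖x‖ ^ (4 * m - 2) := by
  obtain rfl : G = fun x => 2 * F x ^ 2 - ‖x‖ ^ (2 * m) := funext hG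
  refine ⟨hF.two_mul_sq_sub_norm_pow, fun x => ?_⟩
  rw [((hF.differentiable x).hasGradientAt.two_mul_sq_sub_norm_pow m).gradient,
    norm_sub_sq_real, norm_smul, norm_smul, mul_pow, mul_pow, hgrad, inner_smul_left,
    inner_smul_right, hF.inner_gradient_self, Real.norm_eq_abs, Real.norm_eq_abs, sq_abs, sq_abs]
  obtain ⟨k, rfl⟩ : ∃ k, m = k + 1 := ⟨m - 1, by lia⟩
  rw [show 2 * (k + 1) - 2 = 2 * k by lia, show 4 * (k + 1) - 2 = 4 * k + 2 by lia]
  simp only [conj_trivial]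
  ring
end
end

section
/- Let n ≥ 2, m ≥ 1, and let F : ℝⁿ → ℝ be a homogeneous polynomial of degree m satisfying ‖∇F(x)‖² = m²‖x‖^(2m−2) for all x ∈ ℝⁿ. If F is not constant on the unit sphere, then for every t ∈ [−1,1] there exists x with ‖x‖ = 1 and F(x) = t; in particular the image of the unit sphere under F is exactly the interval [−1,1]. -/
noncomputable section

lemma IsHomPoly.differentiable_s15 {n m : ℕ} {F : EuclideanSpace ℝ (Fin n) → ℝ}
    (hF : IsHomPoly n m F) : Differentiable ℝ F := by
  obtain ⟨P, -, hP⟩ := hF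
  rw [show F = fun x => MvPolynomial.eval (fun i => x i) P from funext hP]
  clear hP
  induction P using MvPolynomial.induction_on with
  | C a => simp
  | add p q hp hq =>
    simp only [map_add]
    exact hp.add hq
  | mul_X p i hp =>
    simp only [map_mul, MvPolynomial.eval_X]
    exact hp.mul (by fun_prop)

lemma IsHomPoly.map_smul_s15 {n m : ℕ} {F : EuclideanSpace ℝ (Fin n) → ℝ}
    (hF : IsHomPoly n m F) (c : ℝ) (x : EuclideanSpace ℝ (Fin n)) :
    F (c • x) = c ^ m * F x := by
  obtain ⟨P, hP, h⟩ := hF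
  rw [h, h, MvPolynomial.eval_eq, MvPolynomial.eval_eq, Finset.mul_sum]
  refine Finset.sum_congr rfl fun d hd => ?_
  have hdeg : ∑ i ∈ d.support, d i = m := by
    have := hP (MvPolynomial.mem_support_iff.mp hd)
    rwa [Finsupp.weight_apply, Finsupp.sum, Finset.sum_congr rfl (g := fun i => d i)
      (fun i _ => by simp)] at this
  simp only [PiLp.smul_apply, smul_eq_mul, mul_pow, Finset.prod_mul_distrib,
    Finset.prod_pow_eq_pow_sum, hdeg]
  ring

lemma IsHomPoly.neg {n m : ℕ} {F : EuclideanSpace ℝ (Fin n) → ℝ}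
    (hF : IsHomPoly n m F) : IsHomPoly n m (-F) := by
  obtain ⟨P, hP, h⟩ := hF
  exact ⟨-P, hP.neg, fun x => by simp [h]⟩

/-- At a maximum point on the unit sphere, the derivative of a function that is
homogeneous of degree `m` is `m` times the maximum times the inner product with that point. -/
lemma fderiv_eq_smul_innerSL_of_isMaxOn_sphere {E : Type*} [NormedAddCommGroup E]
    [InnerProductSpace ℝ E]
    {m : ℕ} {G : E → ℝ} {x : E} (hx : ‖x‖ = 1) (hG : DifferentiableAt ℝ G x)
    (hhom : ∀ (c : ℝ) (y : E), G (c • y) = c ^ m * G y)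
    (hmax : ∀ y : E, ‖y‖ = 1 → G y ≤ G x) :
    fderiv ℝ G x = (m * G x) • innerSL ℝ x := by
  have hnorm : HasFDerivAt (fun y : E => ‖y‖) (innerSL ℝ x) x := by
    have h := (hasStrictFDerivAt_norm_sq x).hasFDerivAt.sqrt (by simp [hx])
    have hsmul : (2⁻¹ : ℝ) • (2 : ℕ) • innerSL ℝ x = innerSL ℝ x := by
      ext v
      simp
    simpa [hx, hsmul] using h
  have hf := hG.hasFDerivAt.sub ((hnorm.pow m).const_mul (G x))
  have hloc : IsLocalMax (fun y : E => G y - G x * ‖y‖ ^ m) x := by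
    have hx0 : x ≠ 0 := by rintro rfl; simp at hx
    filter_upwards [isOpen_ne.mem_nhds hx0] with y hy
    have hy0 : ‖y‖ ≠ 0 := norm_ne_zero_iff.mpr hy
    have h1 : G y = ‖y‖ ^ m * G (‖y‖⁻¹ • y) := by rw [← hhom, smul_inv_smul₀ hy0]
    have h2 := hmax (‖y‖⁻¹ • y) (by rw [norm_smul, norm_inv, norm_norm, inv_mul_cancel₀ hy0])
    have h3 : ‖y‖ ^ m * G (‖y‖⁻¹ • y) ≤ ‖y‖ ^ m * G x := by gcongr
    simp only [hx, one_pow]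
    linarith
  have h0 := sub_eq_zero.mp (hloc.hasFDerivAt_eq_zero hf)
  rw [h0]
  simp [hx, smul_smul, mul_comm]

/-- The maximum on the unit sphere of a homogeneous solution of the eiconal equation is `±1`. -/
lemma eq_one_or_eq_neg_one_of_isMaxOn_sphere {E : Type*} [NormedAddCommGroup E]
    [InnerProductSpace ℝ E] {m : ℕ} (hm : 1 ≤ m) {G : E → ℝ} {x : E} (hx : ‖x‖ = 1)
    (hG : DifferentiableAt ℝ G x) (hhom : ∀ (c : ℝ) (y : E), G (c • y) = c ^ m * G y)
    (hgrad : ‖fderiv ℝ G x‖ ^ 2 = (m : ℝ) ^ 2) (hmax : ∀ y : E, ‖y‖ = 1 → G y ≤ G x) :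
    G x = 1 ∨ G x = -1 := by
  rw [fderiv_eq_smul_innerSL_of_isMaxOn_sphere hx hG hhom hmax, norm_smul, innerSL_apply_norm, hx,
    mul_one, Real.norm_eq_abs, sq_abs, mul_pow] at hgrad
  have hm0 : (m : ℝ) ^ 2 ≠ 0 := by positivity
  exact sq_eq_one_iff.mp (mul_left_cancel₀ hm0 (by rw [hgrad, mul_one]))

/-- If a homogeneous polynomial solution of the eiconal equation is not constant on the unit
sphere, then its image on the unit sphere is exactly the interval `[-1, 1]`. -/
theorem surjective_onto_Icc {n m : ℕ} (hn : 2 ≤ n) (hm : 1 ≤ m)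
    (F : EuclideanSpace ℝ (Fin n) → ℝ) (hF : IsHomPoly n m F)
    (hgrad : ∀ x : EuclideanSpace ℝ (Fin n),
      ‖gradient F x‖ ^ 2 = (m : ℝ) ^ 2 * ‖x‖ ^ (2 * m - 2))
    (hnc : ¬ ∀ x y : EuclideanSpace ℝ (Fin n), ‖x‖ = 1 → ‖y‖ = 1 → F x = F y) :
    (∀ t ∈ Set.Icc (-1 : ℝ) 1, ∃ x : EuclideanSpace ℝ (Fin n), ‖x‖ = 1 ∧ F x = t) ∧
      F '' {x : EuclideanSpace ℝ (Fin n) | ‖x‖ = 1} = Set.Icc (-1 : ℝ) 1 := by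
  have hfd : ∀ x : EuclideanSpace ℝ (Fin n), ‖x‖ = 1 → ‖fderiv ℝ F x‖ ^ 2 = (m : ℝ) ^ 2 := by
    intro x hx
    have h := hgrad x
    rwa [gradient, LinearIsometryEquiv.norm_map, hx, one_pow, mul_one] at h
  have hcont : Continuous F := hF.differentiable_s15.continuous
  have hconn : IsPreconnected (Metric.sphere (0 : EuclideanSpace ℝ (Fin n)) 1) :=
    isPreconnected_sphere (by
      rw [← Module.finrank_eq_rank, finrank_euclideanSpace_fin]; exact_mod_cast hn) 0 1
  have hcomp := isCompact_sphere (0 : EuclideanSpace ℝ (Fin n)) 1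
  have hne : (Metric.sphere (0 : EuclideanSpace ℝ (Fin n)) 1).Nonempty := by
    push Not at hnc
    obtain ⟨x, -, hx, -⟩ := hnc
    exact ⟨x, by simpa using hx⟩
  obtain ⟨a, ha, hmax⟩ := hcomp.exists_isMaxOn hne hcont.continuousOn
  obtain ⟨b, hb, hmin⟩ := hcomp.exists_isMinOn hne hcont.continuousOn
  have ha1 : ‖a‖ = 1 := by simpa using ha
  have hb1 : ‖b‖ = 1 := by simpa using hb
  have hmax' : ∀ y, ‖y‖ = 1 → F y ≤ F a := fun y hy => hmax (by simpa using hy)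
  have hmin' : ∀ y, ‖y‖ = 1 → F b ≤ F y := fun y hy => hmin (by simpa using hy)
  have hFa := eq_one_or_eq_neg_one_of_isMaxOn_sphere hm ha1 (hF.differentiable_s15 a) hF.map_smul_s15
    (hfd a ha1) hmax'
  have hFb := eq_one_or_eq_neg_one_of_isMaxOn_sphere (G := -F) hm hb1 (hF.neg.differentiable_s15 b)
    hF.neg.map_smul_s15 (by rw [fderiv_neg, norm_neg, hfd b hb1]) fun y hy => neg_le_neg (hmin' y hy)
  simp only [Pi.neg_apply, neg_inj] at hFb
  have hlt : F b < F a := by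
    by_contra! hle
    exact hnc fun x y hx hy => by linarith [hmax' x hx, hmin' x hx, hmax' y hy, hmin' y hy]
  have hval : F a = 1 ∧ F b = -1 := by
    rcases hFa with h | h <;> rcases hFb with h' | h' <;> constructor <;> linarith
  have hsurj : ∀ t ∈ Set.Icc (-1 : ℝ) 1, ∃ x : EuclideanSpace ℝ (Fin n), ‖x‖ = 1 ∧ F x = t := by
    intro t ht
    rw [← hval.2, ← hval.1] at ht
    obtain ⟨x, hx, hxt⟩ := hconn.intermediate_value hb ha hcont.continuousOn ht
    exact ⟨x, by simpa using hx, hxt⟩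
  refine ⟨hsurj, Set.Subset.antisymm ?_ hsurj⟩
  rintro _ ⟨x, hx, rfl⟩
  exact ⟨hval.2 ▸ hmin' x hx, hval.1 ▸ hmax' x hx⟩
end
end
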